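/- arXiv:math/9810123 — 3 statements merged into one kernel-verified Lean document; each statement's English description precedes it below -/
import Mathlib

section
/- Let n ≥ 3 and let a = (a_{ij}) be a block matrix in the 2n-cycle algebra A(m) ⊆ M_N(ℂ). If a is a partial isometry (a aᴴ a = a) and both aᴴa and a aᴴ lie in A(m) (equivalently, are block diagonal), then every block entry a_{ij} of a is a partial isometry. -/
open Matrix

/-- Index set for `N × N` block matrices with block sizes `m i`, `i ∈ ℤ/2n`. -/
abbrev CycleIdx (n : ℕ) (m : ZMod (2 * n) → ℕ) : Type := (i : ZMod (2 * n)) × Fin (m i)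

/-- The pairs of block indices allowed to be nonzero in a `2n`-cycle algebra:
`i = j`, or `i` odd (with representatives `1, …, 2n`) and `j ≡ i ± 1 (mod 2n)`. -/
def cycleAllowed (n : ℕ) (i j : ZMod (2 * n)) : Prop :=
  i = j ∨ (Odd i.val ∧ (j = i - 1 ∨ j = i + 1))

/-- The `2n`-cycle algebra `A(m) ⊆ M_N(ℂ)`. -/
def cycleAlg (n : ℕ) (m : ZMod (2 * n) → ℕ) :
    Set (Matrix (CycleIdx n m) (CycleIdx n m) ℂ) :=
  {a | ∀ (i j : ZMod (2 * n)) (x : Fin (m i)) (y : Fin (m j)),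
      ¬ cycleAllowed n i j → a ⟨i, x⟩ ⟨j, y⟩ = 0}

/-- The `(i,j)` block entry of a block matrix. -/
def blockOf {n : ℕ} {m : ZMod (2 * n) → ℕ}
    (a : Matrix (CycleIdx n m) (CycleIdx n m) ℂ) (i j : ZMod (2 * n)) :
    Matrix (Fin (m i)) (Fin (m j)) ℂ :=
  fun x y => a ⟨i, x⟩ ⟨j, y⟩

/-- A (possibly rectangular) complex matrix `u` is a partial isometry if `u uᴴ u = u`. -/
def IsPartialIsometry {p q : Type*} [Fintype p] [Fintype q]
    (u : Matrix p q ℂ) : Prop :=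
  u * uᴴ * u = u

/-- The parity reduction `ZMod (2 * n) → ZMod 2` separates the two ends of an off-diagonal
allowed pair. -/
lemma cycleAllowed.eq_or_parity {n : ℕ} [NeZero n] {i j : ZMod (2 * n)}
    (h : cycleAllowed n i j) :
    i = j ∨ (ZMod.castHom (Dvd.intro n rfl) (ZMod 2) i = 1 ∧
      ZMod.castHom (Dvd.intro n rfl) (ZMod 2) j = 0 ∧ (j = i - 1 ∨ j = i + 1)) := by
  rcases h with h | ⟨hi, h⟩
  · exact Or.inl h
  · have h1 : ZMod.castHom (Dvd.intro n rfl) (ZMod 2) i = 1 := by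
      rw [← ZMod.natCast_zmod_val i, map_natCast]
      exact (ZMod.natCast_eq_one_iff_odd).2 hi
    refine Or.inr ⟨h1, ?_, h⟩
    rcases h with rfl | rfl
    · rw [map_sub, h1, map_one, sub_self]
    · rw [map_add, h1, map_one]
      decide

lemma cycleAllowed.eq_of_symm {n : ℕ} [NeZero n] {i j : ZMod (2 * n)}
    (h : cycleAllowed n i j) (h' : cycleAllowed n j i) : i = j := by
  rcases h.eq_or_parity with h | ⟨h1, -, -⟩
  · exact h
  rcases h'.eq_or_parity with h' | ⟨-, h2, -⟩
  · exact h'.symm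
  exact absurd (h1.symm.trans h2) one_ne_zero

/-- For `n ≥ 3`, two distinct rows of the pattern of a `2n`-cycle algebra share at most one
column. -/
lemma cycleAllowed.column_unique {n : ℕ} [NeZero n] (hn : 3 ≤ n) {i k l l' : ZMod (2 * n)}
    (hik : i ≠ k) (hil : cycleAllowed n i l) (hkl : cycleAllowed n k l)
    (hil' : cycleAllowed n i l') (hkl' : cycleAllowed n k l') : l = l' := by
  have h4 : (4 : ZMod (2 * n)) ≠ 0 := by
    intro h
    have h' : ((4 : ℕ) : ZMod (2 * n)) = 0 := by exact_mod_cast h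
    rw [ZMod.natCast_eq_zero_iff] at h'
    have := Nat.le_of_dvd (by norm_num) h'
    omega
  have h01 : (1 : ZMod 2) ≠ 0 := one_ne_zero
  have h1 := hil.eq_or_parity
  have h2 := hkl.eq_or_parity
  have h3 := hil'.eq_or_parity
  have h5 := hkl'.eq_or_parity
  generalize ZMod.castHom (Dvd.intro n rfl) (ZMod 2) = f at *
  clear hil hkl hil' hkl'
  rcases h1 with h1 | ⟨a1, b1, c1 | c1⟩ <;> rcases h2 with h2 | ⟨a2, b2, c2 | c2⟩ <;>
    rcases h3 with h3 | ⟨a3, b3, c3 | c3⟩ <;> rcases h5 with h5 | ⟨a4, b4, c4 | c4⟩ <;> grind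

lemma blockOf_conjTranspose {n : ℕ} {m : ZMod (2 * n) → ℕ}
    (a : Matrix (CycleIdx n m) (CycleIdx n m) ℂ) (i j : ZMod (2 * n)) :
    blockOf aᴴ i j = (blockOf a j i)ᴴ := rfl

lemma blockOf_mul {n : ℕ} [NeZero n] {m : ZMod (2 * n) → ℕ}
    (a b : Matrix (CycleIdx n m) (CycleIdx n m) ℂ) (i j : ZMod (2 * n)) :
    blockOf (a * b) i j = ∑ k, blockOf a i k * blockOf b k j := by
  ext x y
  simp only [blockOf, Matrix.mul_apply, Fintype.sum_sigma, Matrix.sum_apply]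

lemma blockOf_eq_zero {n : ℕ} {m : ZMod (2 * n) → ℕ}
    {a : Matrix (CycleIdx n m) (CycleIdx n m) ℂ} (ha : a ∈ cycleAlg n m)
    {i j : ZMod (2 * n)} (h : ¬ cycleAllowed n i j) : blockOf a i j = 0 := by
  ext x y
  exact ha i j x y h

/-- A hermitian element of a cycle algebra is block diagonal. -/
lemma blockOf_eq_zero_of_isHermitian {n : ℕ} [NeZero n] {m : ZMod (2 * n) → ℕ}
    {a : Matrix (CycleIdx n m) (CycleIdx n m) ℂ} (ha : a ∈ cycleAlg n m)
    (hh : a.IsHermitian) {i j : ZMod (2 * n)} (hij : i ≠ j) : blockOf a i j = 0 := by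
  by_cases h : cycleAllowed n i j
  · have h' : ¬ cycleAllowed n j i := fun h' => hij (h.eq_of_symm h')
    rw [← hh.eq, blockOf_conjTranspose, blockOf_eq_zero ha h', conjTranspose_zero]
  · exact blockOf_eq_zero ha h

/-- Blocks of `a` in the same column and in distinct rows have orthogonal initial spaces as
soon as `a * aᴴ` lies in the cycle algebra. -/
lemma blockOf_mul_conjTranspose_eq_zero {n : ℕ} [NeZero n] (hn : 3 ≤ n)
    {m : ZMod (2 * n) → ℕ} {a : Matrix (CycleIdx n m) (CycleIdx n m) ℂ}
    (ha : a ∈ cycleAlg n m) (hfin : a * aᴴ ∈ cycleAlg n m) {i k : ZMod (2 * n)} (hik : i ≠ k)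
    (j : ZMod (2 * n)) : blockOf a i j * (blockOf a k j)ᴴ = 0 := by
  by_cases hi : cycleAllowed n i j
  swap
  · rw [blockOf_eq_zero ha hi, Matrix.zero_mul]
  by_cases hk : cycleAllowed n k j
  swap
  · rw [blockOf_eq_zero ha hk, conjTranspose_zero, Matrix.mul_zero]
  have h := blockOf_eq_zero_of_isHermitian hfin (isHermitian_mul_conjTranspose_self a) hik
  rw [blockOf_mul, Finset.sum_eq_single j] at h
  · exact h
  · intro l _ hl
    rw [blockOf_conjTranspose]
    by_cases hil : cycleAllowed n i l
    · have hkl : ¬ cycleAllowed n k l := fun hkl =>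
        hl (cycleAllowed.column_unique hn hik hil hkl hi hk)
      rw [blockOf_eq_zero ha hkl, conjTranspose_zero, Matrix.mul_zero]
    · rw [blockOf_eq_zero ha hil, Matrix.zero_mul]
  · exact fun h => absurd (Finset.mem_univ j) h

/-- Lemma 2.1. Let `n ≥ 3` and let `a = (a_{ij})` be a block matrix in the
`2n`-cycle algebra `A(m) ⊆ M_N(ℂ)`.  If `a` is a partial isometry (`a aᴴ a = a`) and both
`aᴴ a` and `a aᴴ` lie in `A(m)`, then every block entry `a_{ij}` of `a` is a partial
isometry. -/
theorem blocks_of_partialIsometry_in_cycleAlg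
    (n : ℕ) [NeZero n] (hn : 3 ≤ n)
    (m : ZMod (2 * n) → ℕ) (hm : ∀ i, 1 ≤ m i)
    (a : Matrix (CycleIdx n m) (CycleIdx n m) ℂ)
    (ha : a ∈ cycleAlg n m)
    (hpi : IsPartialIsometry a)
    (hinit : aᴴ * a ∈ cycleAlg n m)
    (hfin : a * aᴴ ∈ cycleAlg n m) :
    ∀ i j : ZMod (2 * n), IsPartialIsometry (blockOf a i j) := by
  intro i j
  have h : blockOf (a * (aᴴ * a)) i j = blockOf a i j := by
    rw [← Matrix.mul_assoc, show a * aᴴ * a = a from hpi]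
  rw [blockOf_mul, Finset.sum_eq_single j] at h
  · rw [blockOf_mul, Matrix.mul_sum, Finset.sum_eq_single i] at h
    · rwa [blockOf_conjTranspose, ← Matrix.mul_assoc] at h
    · intro k _ hk
      rw [blockOf_conjTranspose, ← Matrix.mul_assoc,
        blockOf_mul_conjTranspose_eq_zero hn ha hfin hk.symm, Matrix.zero_mul]
    · exact fun h => absurd (Finset.mem_univ i) h
  · intro k _ hk
    rw [blockOf_eq_zero_of_isHermitian hinit (isHermitian_conjTranspose_mul_self a) hk,
      Matrix.mul_zero]
  · exact fun h => absurd (Finset.mem_univ j) h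
end

section
/- Let n ≥ 2 and let θ₁,…,θ_{2n} be the 2n dihedral permutations of ℤ/2n given by θ_{2k−1}(v) = v − 2(k−1) and θ_{2k}(v) = 2 − v + 2(k−1) for 1 ≤ k ≤ n, with permutation matrices P_{θ_j} ∈ M_{2n}(ℤ). For integers r₁,…,r_{2n}, one has Σ_{j=1}^{2n} r_j P_{θ_j} = 0 if and only if there is an integer k with r_j = k for all odd j and r_j = −k for all even j. Consequently, the map (r₁,…,r_{2n}) ↦ (Σ_j r_j P_{θ_j}, r₁ − r₂ + r₃ − ⋯ − r_{2n}) is injective on ℤ^{2n}: the K₀ matrix together with the alternating (homology) sum determines the multiplicity signature. -/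
/-- The `2n` dihedral permutations of `ℤ/2n`, indexed by `j : Fin (2n)` whose 1-based label
is `j.val + 1`: in 1-based labels, `θ_{2k−1}(v) = v − 2(k−1)` and `θ_{2k}(v) = 2 − v + 2(k−1)`
for `1 ≤ k ≤ n`. -/
def dihedralPerm (n : ℕ) (j : Fin (2 * n)) : ZMod (2 * n) → ZMod (2 * n) :=
  if Even j.val then fun v => v - (j.val : ZMod (2 * n))
  else fun v => ((j.val : ZMod (2 * n)) + 1) - v

/-- The permutation matrix `P_θ ∈ M_{2n}(ℤ)` of `θ : ℤ/2n → ℤ/2n`: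
`(P_θ)_{iv} = 1` if `θ(v) = i` and `0` otherwise. -/
def permMat (n : ℕ) (θ : ZMod (2 * n) → ZMod (2 * n)) :
    Matrix (ZMod (2 * n)) (ZMod (2 * n)) ℤ :=
  fun i v => if θ v = i then 1 else 0

/-- The alternating sum `r₁ − r₂ + r₃ − ⋯ − r_{2n}` (1-based labels, so the 1-based odd
terms are the `j : Fin (2n)` with `j.val` even). -/
def altSum (n : ℕ) (r : Fin (2 * n) → ℤ) : ℤ :=
  ∑ j : Fin (2 * n), if Even j.val then r j else -(r j)

theorem natCast_zmod_fin_inj {m : ℕ} (a b : Fin m) :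
    ((a.val : ZMod m) = (b.val : ZMod m)) ↔ a = b := by
  rw [ZMod.natCast_eq_natCast_iff, Fin.ext_iff]
  exact ⟨fun h => Nat.ModEq.eq_of_lt_of_lt h a.isLt b.isLt, fun h => by rw [h]⟩

theorem sum_smul_permMat_apply (n : ℕ) (r : Fin (2 * n) → ℤ) (i v : ZMod (2 * n))
    (a b : Fin (2 * n)) (ha : (a.val : ZMod (2 * n)) = v - i)
    (hb : (b.val : ZMod (2 * n)) = v + i - 1) :
    (∑ j : Fin (2 * n), r j • permMat n (dihedralPerm n j)) i v =
      (if Even a.val then r a else 0) + (if Even b.val then 0 else r b) := by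
  have key : ∀ j : Fin (2 * n), r j * permMat n (dihedralPerm n j) i v =
      (if j = a then (if Even j.val then r j else 0) else 0) +
        (if j = b then (if Even j.val then 0 else r j) else 0) := by
    intro j
    have h1 : v - (j.val : ZMod (2 * n)) = i ↔ j = a := by
      rw [← natCast_zmod_fin_inj, ha]
      constructor <;> intro h
      · rw [← h]; ring
      · rw [h]; ring
    have h2 : (j.val : ZMod (2 * n)) + 1 - v = i ↔ j = b := by
      rw [← natCast_zmod_fin_inj, hb]
      constructor <;> intro h
      · rw [← h]; ring
      · rw [h]; ring
    by_cases hj : Even j.val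
    · simp [permMat, dihedralPerm, hj, h1]
    · simp [permMat, dihedralPerm, hj, h2]
  simp only [Matrix.sum_apply, Matrix.smul_apply, smul_eq_mul, key, Finset.sum_add_distrib,
    Finset.sum_ite_eq', Finset.mem_univ, if_true]

theorem sum_smul_permMat_eq_zero_iff (n : ℕ) (hn : 0 < n) (r : Fin (2 * n) → ℤ) :
    (∑ j : Fin (2 * n), r j • permMat n (dihedralPerm n j)) = 0 ↔
      ∃ k : ℤ, ∀ j : Fin (2 * n), r j = if Even j.val then k else -k := by
  constructor
  · intro h
    have rel : ∀ a b : Fin (2 * n), Even a.val → ¬ Even b.val → r a + r b = 0 := by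
      intro a b ha hb
      obtain ⟨c, hc⟩ : Even (a.val + b.val + 1) := by grind
      have hc' : (a.val : ZMod (2 * n)) + b.val + 1 = c + c := by exact_mod_cast congrArg _ hc
      have := sum_smul_permMat_apply n r ((c : ZMod (2 * n)) - a.val) c a b (by ring)
        (by linear_combination hc')
      simpa [h, ha, hb] using this.symm
    refine ⟨r ⟨0, by omega⟩, fun j => ?_⟩
    have h01 := rel ⟨0, by omega⟩ ⟨1, by omega⟩ (by simp) (by simp)
    split_ifs with hj
    · have := rel j ⟨1, by omega⟩ hj (by simp)
      linarith
    · have := rel ⟨0, by omega⟩ j (by simp) hj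
      linarith
  · rintro ⟨k, hk⟩
    have : NeZero (2 * n) := ⟨by omega⟩
    ext i v
    rw [sum_smul_permMat_apply n r i v ⟨(v - i).val, ZMod.val_lt _⟩
      ⟨(v + i - 1).val, ZMod.val_lt _⟩ (ZMod.natCast_zmod_val _) (ZMod.natCast_zmod_val _)]
    have hmod : (v - i).val + 2 * i.val ≡ (v + i - 1).val + 1 [MOD 2 * n] := by
      rw [← ZMod.natCast_eq_natCast_iff]
      push_cast [ZMod.natCast_zmod_val]
      ring
    have hpar : Even (v - i).val ↔ ¬ Even (v + i - 1).val := by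
      have := hmod.of_mul_right n
      unfold Nat.ModEq at this
      simp only [Nat.even_iff]
      omega
    by_cases he : Even (v + i - 1).val <;> simp [hk, hpar, he]

theorem altSum_sub (n : ℕ) (r s : Fin (2 * n) → ℤ) :
    altSum n (r - s) = altSum n r - altSum n s := by
  simp only [altSum, ← Finset.sum_sub_distrib, Pi.sub_apply]
  refine Finset.sum_congr rfl fun j _ => ?_
  split_ifs <;> ring

/-- For `n ≥ 2` and integers `r₁, …, r_{2n}`, one has
`Σ_j r_j P_{θ_j} = 0` iff there is `k : ℤ` with `r_j = k` for all (1-based) odd `j` and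
`r_j = −k` for all even `j`.  Consequently the map sending `(r₁,…,r_{2n})` to the pair
`(Σ_j r_j P_{θ_j}, r₁ − r₂ + ⋯ − r_{2n})` is injective: the `K₀` matrix together with the
alternating homology sum determines the multiplicity signature. -/
theorem permMat_relation_and_K0H1_injective (n : ℕ) (hn : 2 ≤ n) :
    (∀ r : Fin (2 * n) → ℤ,
      (∑ j : Fin (2 * n), r j • permMat n (dihedralPerm n j)) = 0 ↔
        ∃ k : ℤ, ∀ j : Fin (2 * n), r j = if Even j.val then k else -k) ∧
    Function.Injective (fun r : Fin (2 * n) → ℤ =>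
      ((∑ j : Fin (2 * n), r j • permMat n (dihedralPerm n j)), altSum n r)) := by
  refine ⟨sum_smul_permMat_eq_zero_iff n (by omega), fun r s hrs => ?_⟩
  obtain ⟨hM, hA⟩ := Prod.ext_iff.mp hrs
  dsimp only at hM hA
  obtain ⟨k, hk⟩ := (sum_smul_permMat_eq_zero_iff n (by omega) (r - s)).mp (by
    simp only [Pi.sub_apply, sub_smul, Finset.sum_sub_distrib, hM, sub_self])
  have hsum : altSum n (r - s) = 2 * n * k := by
    have : ∀ j : Fin (2 * n), (if Even j.val then (r - s) j else -(r - s) j) = k := by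
      intro j
      rw [hk]
      split_ifs <;> simp
    simp only [altSum, this]
    simp
  rw [altSum_sub, hA, sub_self] at hsum
  have hk0 : k = 0 := by
    have : (2 * n : ℤ) ≠ 0 := by positivity
    exact (mul_eq_zero.mp hsum.symm).resolve_left this
  funext j
  have := hk j
  simp only [hk0, neg_zero, ite_self, Pi.sub_apply] at this
  linarith
end

section
/- Let d ≥ 1 be an integer, let θ₁,…,θ₆ be the six dihedral permutations of ℤ/6 given by θ_{2k−1}(v) = v − 2(k−1) and θ_{2k}(v) = 2 − v + 2(k−1) for k = 1,2,3, with permutation matrices P_{θ_j} ∈ M₆(ℤ), and let J ∈ M₆(ℤ) be the matrix with (i,v)-entry equal to 1 when i − v is even and 0 otherwise. Then for nonnegative integers r₁,…,r₆ one has Σ_{j=1}^{6} r_j P_{θ_j} = d·J if and only if there is an integer a with 0 ≤ a ≤ d, r_j = a for all odd j, and r_j = d − a for all even j. Consequently the set of achievable alternating sums r₁ − r₂ + r₃ − r₄ + r₅ − r₆ subject to Σ_j r_j P_{θ_j} = d·J is exactly the (d+1)-element set {−3d, −3d+6, …, 3d−6, 3d}. -/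
/-- The matrix `J ∈ M₆(ℤ)` with `(i,v)` entry `1` when `i − v` is even, `0` otherwise. -/
def Jmat : Matrix (ZMod (2 * 3)) (ZMod (2 * 3)) ℤ :=
  fun i v => if Even (i - v).val then 1 else 0

/-- Entrywise form of the equation `Σ_j r_j P_{θ_j} = d·J`: every rotation multiplicity and every
reflection multiplicity add up to `d`. -/
theorem sum_permMat_eq_smul_Jmat_iff (d : ℕ) (r : Fin (2 * 3) → ℕ) :
    (∑ j : Fin (2 * 3), (r j : ℤ) • permMat 3 (dihedralPerm 3 j)) = (d : ℤ) • Jmat ↔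
      ∀ j k : Fin (2 * 3), Even j.val → ¬ Even k.val → r j + r k = d := by
  have entry_even : ∀ i v : ZMod (2 * 3), Even (i - v).val → ∃ j k : Fin (2 * 3),
      Even j.val ∧ ¬ Even k.val ∧ ∀ l : Fin (2 * 3), permMat 3 (dihedralPerm 3 l) i v =
        (if l = j then 1 else 0) + (if l = k then 1 else 0) := by decide
  have entry_odd : ∀ i v : ZMod (2 * 3), ¬ Even (i - v).val → ∀ l : Fin (2 * 3),
      permMat 3 (dihedralPerm 3 l) i v = 0 := by decide
  have exists_entry : ∀ j k : Fin (2 * 3), Even j.val → ¬ Even k.val → ∃ i v : ZMod (2 * 3),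
      Even (i - v).val ∧ ∀ l : Fin (2 * 3), permMat 3 (dihedralPerm 3 l) i v =
        (if l = j then 1 else 0) + (if l = k then 1 else 0) := by decide
  constructor
  · intro h j k hj hk
    obtain ⟨i, v, hiv, hl⟩ := exists_entry j k hj hk
    have e := congrFun (congrFun h i) v
    simp only [Matrix.sum_apply, Matrix.smul_apply, hl, Jmat, hiv, smul_eq_mul, mul_add,
      Finset.sum_add_distrib, mul_ite, mul_one, mul_zero, Finset.sum_ite_eq', Finset.mem_univ,
      if_true] at e
    exact_mod_cast e
  · intro h
    ext i v
    by_cases hiv : Even (i - v).val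
    · obtain ⟨j, k, hj, hk, hl⟩ := entry_even i v hiv
      simp only [Matrix.sum_apply, Matrix.smul_apply, hl, Jmat, hiv, smul_eq_mul, mul_add,
        Finset.sum_add_distrib, mul_ite, mul_one, mul_zero, Finset.sum_ite_eq', Finset.mem_univ,
        if_true]
      exact_mod_cast h j k hj hk
    · simp only [Matrix.sum_apply, Matrix.smul_apply, entry_odd i v hiv, Jmat, hiv, smul_zero,
        Finset.sum_const_zero, if_false]

/-- The solutions of `Σ_j r_j P_{θ_j} = d·J` in nonnegative integers. -/
theorem sum_permMat_eq_smul_Jmat_iff_exists (d : ℕ) (r : Fin (2 * 3) → ℕ) :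
    (∑ j : Fin (2 * 3), (r j : ℤ) • permMat 3 (dihedralPerm 3 j)) = (d : ℤ) • Jmat ↔
      ∃ a : ℕ, a ≤ d ∧ ∀ j : Fin (2 * 3), r j = if Even j.val then a else d - a := by
  rw [sum_permMat_eq_smul_Jmat_iff]
  constructor
  · intro h
    have h01 := h 0 1 (by decide) (by decide)
    refine ⟨r 0, by omega, fun j => ?_⟩
    split_ifs with hj
    · have := h j 1 hj (by decide)
      omega
    · have := h 0 j (by decide) hj
      omega
  · rintro ⟨a, ha, hr⟩ j k hj hk
    rw [hr j, hr k, if_pos hj, if_neg hk]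
    omega

/-- The alternating sum of the multiplicities equal to `a` on rotations and `d - a` on
reflections. -/
theorem altSum_ite (d a : ℕ) (ha : a ≤ d) (r : Fin (2 * 3) → ℕ)
    (hr : ∀ j : Fin (2 * 3), r j = if Even j.val then a else d - a) :
    altSum 3 (fun j => (r j : ℤ)) = 6 * a - 3 * d := by
  have hterm : ∀ j : Fin (2 * 3), (if Even j.val then (r j : ℤ) else -(r j : ℤ)) =
      if Even j.val then (a : ℤ) else a - d := by
    intro j
    rw [hr j]
    split_ifs <;> omega
  have hcard : (Finset.univ.filter fun j : Fin (2 * 3) => Even j.val).card = 3 := by decide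
  have hcard' : (Finset.univ.filter fun j : Fin (2 * 3) => ¬ Even j.val).card = 3 := by decide
  simp only [altSum, hterm, Finset.sum_ite, Finset.sum_const, hcard, hcard', nsmul_eq_mul]
  push_cast
  ring

/-- For `d ≥ 1` and nonnegative integers `r₁, …, r₆`, one has
`Σ_{j=1}^{6} r_j P_{θ_j} = d·J` iff there is `a` with `0 ≤ a ≤ d`, `r_j = a` for (1-based)
odd `j` and `r_j = d − a` for even `j`; consequently the achievable alternating sums
`r₁ − r₂ + r₃ − r₄ + r₅ − r₆` form exactly the `(d+1)`-element set
`{−3d, −3d+6, …, 3d−6, 3d} = {6a − 3d : 0 ≤ a ≤ d}`. -/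
theorem stationary_sixCycle_homology_values (d : ℕ) (hd : 1 ≤ d) :
    (∀ r : Fin (2 * 3) → ℕ,
      (∑ j : Fin (2 * 3), (r j : ℤ) • permMat 3 (dihedralPerm 3 j)) = (d : ℤ) • Jmat ↔
        ∃ a : ℕ, a ≤ d ∧ ∀ j : Fin (2 * 3), r j = if Even j.val then a else d - a) ∧
    {s : ℤ | ∃ r : Fin (2 * 3) → ℕ,
        (∑ j : Fin (2 * 3), (r j : ℤ) • permMat 3 (dihedralPerm 3 j)) = (d : ℤ) • Jmat ∧
        altSum 3 (fun j => (r j : ℤ)) = s} =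
      {s : ℤ | ∃ a : ℕ, a ≤ d ∧ s = 6 * a - 3 * d} := by
  refine ⟨sum_permMat_eq_smul_Jmat_iff_exists d, Set.ext fun s => ⟨?_, ?_⟩⟩
  · rintro ⟨r, hr, rfl⟩
    obtain ⟨a, ha, h⟩ := (sum_permMat_eq_smul_Jmat_iff_exists d r).1 hr
    exact ⟨a, ha, altSum_ite d a ha r h⟩
  · rintro ⟨a, ha, rfl⟩
    exact ⟨fun j => if Even j.val then a else d - a,
      (sum_permMat_eq_smul_Jmat_iff_exists d _).2 ⟨a, ha, fun _ => rfl⟩,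
      altSum_ite d a ha _ fun _ => rfl⟩
end
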